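/- Suppose condition (C1) holds. Then n − 2/(1−m) − γ_1(m,β) > 0; moreover for all λ_2 > λ_1 > 0 the self-similar profiles satisfy f_{λ_1}(r) < f_{λ_2}(r) for every r ≥ 0, and the radial function x ↦ f_{λ_1}(|x|) − f_{λ_2}(|x|) is NOT Lebesgue integrable on ℝ^n. -/

import Mathlib

open Real Filter MeasureTheory Set Topology

noncomputable section

def Cstar (n : ℕ) (m : ℝ) : ℝ := 2 * m * ((n : ℝ) - 2 - n * m) / (1 - m)

def beta1 (n : ℕ) (m : ℝ) : ℝ := 1 / ((n : ℝ) - 2 - n * m)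

def betaE (n : ℕ) (m : ℝ) : ℝ := m / ((n : ℝ) - 2 - n * m)

def beta2 (n : ℕ) (m : ℝ) : ℝ :=
  Real.sqrt (2 * (1 - m) / ((n : ℝ) - 2 - n * m)) +
    (((n : ℝ) + 2) * m - ((n : ℝ) - 2)) / (2 * ((n : ℝ) - 2 - n * m))

def beta0 (n : ℕ) (m : ℝ) : ℝ := max (beta2 n m) (betaE n m)

def A0 (n : ℕ) (m β : ℝ) : ℝ :=
  (n : ℝ) - 2 - ((n : ℝ) + 2) * m + 2 * β * ((n : ℝ) - 2 - n * m)

def gamma1 (n : ℕ) (m β : ℝ) : ℝ :=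
  (A0 n m β - Real.sqrt ((A0 n m β) ^ 2 - 8 * ((n : ℝ) - 2 - n * m) * (1 - m))) / (2 * (1 - m))

def gamma2 (n : ℕ) (m β : ℝ) : ℝ :=
  (A0 n m β + Real.sqrt ((A0 n m β) ^ 2 - 8 * ((n : ℝ) - 2 - n * m) * (1 - m))) / (2 * (1 - m))

def Acoef1 (n : ℕ) (m β : ℝ) : ℝ := 1 / (1 - m) - β * gamma1 n m β

def Acoef2 (n : ℕ) (m β : ℝ) : ℝ := 1 / (1 - m) - β * gamma2 n m β

/-- Condition (C1). -/
def CondC1 (n : ℕ) (m β : ℝ) : Prop :=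
  beta1 n m < β ∨
    (4 < n ∧ 0 < m ∧ m < ((n : ℝ) - 4) / ((n : ℝ) - 2) ∧ beta0 n m < β ∧ β ≤ beta1 n m)

/-- Condition (C2). -/
def CondC2 (n : ℕ) (m β : ℝ) : Prop :=
  beta0 n m < β ∧ β < beta1 n m ∧
    (n ≤ 4 ∨ (4 < n ∧ ((n : ℝ) - 4) / ((n : ℝ) - 2) < m ∧ m < ((n : ℝ) - 2) / n))

/-- Condition (C3). -/
def CondC3 (n : ℕ) (m β : ℝ) : Prop :=
  β = beta1 n m ∧
    (n ≤ 4 ∨ (4 < n ∧ ((n : ℝ) - 4) / ((n : ℝ) - 2) < m ∧ m < ((n : ℝ) - 2) / n))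

/-- A self-similar profile `f = f_lam`. -/
structure IsProfile (n : ℕ) (m β α lam : ℝ) (f : ℝ → ℝ) : Prop where
  pos : ∀ r, 0 ≤ r → 0 < f r
  smooth : ContDiffOn ℝ 2 f (Set.Ici 0)
  ode : ∀ r, 0 < r →
    deriv (deriv (fun s => f s ^ m)) r + (((n : ℝ) - 1) / r) * deriv (fun s => f s ^ m) r +
      α * f r + β * r * deriv f r = 0
  init : f 0 = lam ^ (2 / (1 - m))
  init' : deriv f 0 = 0
  asymp : Tendsto (fun r => r ^ 2 * f r ^ (1 - m)) atTop (nhds (Cstar n m))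

/-- The Laplacian of `f : ℝ^n → ℝ`. -/
def lap (n : ℕ) (f : EuclideanSpace ℝ (Fin n) → ℝ) (x : EuclideanSpace ℝ (Fin n)) : ℝ :=
  ∑ i : Fin n,
    fderiv ℝ (fun y => fderiv ℝ f y (EuclideanSpace.single i (1 : ℝ))) x
      (EuclideanSpace.single i (1 : ℝ))

/-- The self-similar solution `U_lam(x,t) = (T-t)^α f_lam((T-t)^β |x|)`. -/
def Uself (n : ℕ) (β α T : ℝ) (f : ℝ → ℝ) (x : EuclideanSpace ℝ (Fin n)) (t : ℝ) : ℝ :=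
  (T - t) ^ α * f ((T - t) ^ β * ‖x‖)

/-- A (positive smooth) solution of the Cauchy problem `u_t = Δ(u^m)` on `ℝ^n × (0,T)` with
initial value `u0` taken in `L¹_loc`. -/
structure IsCauchySolution (n : ℕ) (m T : ℝ) (u0 : EuclideanSpace ℝ (Fin n) → ℝ)
    (u : EuclideanSpace ℝ (Fin n) → ℝ → ℝ) : Prop where
  pos : ∀ x, ∀ t ∈ Set.Ioo 0 T, 0 < u x t
  smooth : ContDiffOn ℝ (⊤ : ℕ∞) (fun p : EuclideanSpace ℝ (Fin n) × ℝ => u p.1 p.2)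
    ((Set.univ : Set (EuclideanSpace ℝ (Fin n))) ×ˢ Set.Ioo 0 T)
  pde : ∀ x, ∀ t ∈ Set.Ioo 0 T, deriv (u x) t = lap n (fun y => u y t ^ m) x
  init : ∀ K : Set (EuclideanSpace ℝ (Fin n)), IsCompact K →
    Tendsto (fun t => ∫ x in K, |u x t - u0 x|) (nhdsWithin 0 (Set.Ioi 0)) (nhds 0)

/-- The rescaled solution `ũ(y,τ)`. -/
def resc (n : ℕ) (β α T : ℝ) (u : EuclideanSpace ℝ (Fin n) → ℝ → ℝ)
    (y : EuclideanSpace ℝ (Fin n)) (τ : ℝ) : ℝ :=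
  (T * Real.exp (-τ)) ^ (-α) * u (((T * Real.exp (-τ)) ^ (-β)) • y) (T * (1 - Real.exp (-τ)))

/-- The singular profile `𝒞(y) = (C_*/|y|²)^{1/(1-m)}`. -/
def singC (n : ℕ) (m : ℝ) (y : EuclideanSpace ℝ (Fin n)) : ℝ :=
  (Cstar n m / ‖y‖ ^ 2) ^ (1 / (1 - m))

/-- The weight exponent `p₀`. -/
def pZero (n : ℕ) (m β : ℝ) : ℝ := ((1 - m) / 2) * ((n : ℝ) - 2 / (1 - m) - gamma1 n m β)

/-- The constant `a_*`. -/
def aStar (n : ℕ) (m β : ℝ) : ℝ :=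
  2 * m * pZero n m β / (Cstar n m * (1 - m)) * (gamma1 n m β + 2 * m / (1 - m))

/-- `Φ(s) = (1+w(s))^{1/m} − 1 − w(s)/m`. -/
def Phi (m : ℝ) (w : ℝ → ℝ) (s : ℝ) : ℝ := (1 + w s) ^ (1 / m) - 1 - w s / m

end

theorem monotoneOn_of_hasDerivAt_nonneg {S : Set ℝ} (hS : Convex ℝ S) {g g' : ℝ → ℝ}
    (hg : ∀ x ∈ S, HasDerivAt g (g' x) x) (hg' : ∀ x ∈ S, 0 ≤ g' x) : MonotoneOn g S := by
  refine monotoneOn_of_deriv_nonneg hS (fun x hx => (hg x hx).continuousAt.continuousWithinAt)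
    (fun x hx => (hg x (interior_subset hx)).differentiableAt.differentiableWithinAt) ?_
  intro x hx
  rw [(hg x (interior_subset hx)).deriv]
  exact hg' x (interior_subset hx)

theorem hasDerivAt_integral_of_continuousOn_Ioi {q : ℝ → ℝ} (hq : ContinuousOn q (Ioi 0)) {r : ℝ}
    (hr : 0 < r) : HasDerivAt (fun u => ∫ s in (1 : ℝ)..u, q s) (q r) r := by
  refine intervalIntegral.integral_hasDerivAt_right ?_
    (hq.stronglyMeasurableAtFilter isOpen_Ioi r hr) (hq.continuousAt (Ioi_mem_nhds hr))
  refine (hq.mono fun x hx => ?_).intervalIntegrable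
  exact lt_of_lt_of_le (lt_min one_pos hr) hx.1

/-- A function that starts below a level near `0` and later reaches it has a first hitting time. -/
theorem exists_first_hitting_time {g : ℝ → ℝ} {c r₁ : ℝ} (hg : ContinuousOn g (Ioi 0))
    (h0 : ∀ᶠ r in 𝓝[>] 0, g r < c) (hr₁ : 0 < r₁) (h₁ : c ≤ g r₁) :
    ∃ t, 0 < t ∧ c ≤ g t ∧ ∀ r ∈ Ioo 0 t, g r < c := by
  obtain ⟨δ, hδ, hδ'⟩ := mem_nhdsGT_iff_exists_Ioo_subset.1 h0
  have hδ : 0 < δ := hδ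
  have hsub : Icc (δ / 2) r₁ ⊆ Ioi 0 := fun x hx => lt_of_lt_of_le (by positivity) hx.1
  have hδr : δ ≤ r₁ := by
    by_contra! h
    exact absurd (hδ' ⟨hr₁, h⟩ : g r₁ < c) (not_lt.2 h₁)
  have hclosed : IsClosed (Icc (δ / 2) r₁ ∩ g ⁻¹' Ici c) :=
    (hg.mono hsub).preimage_isClosed_of_isClosed isClosed_Icc isClosed_Ici
  have hcomp : IsCompact (Icc (δ / 2) r₁ ∩ g ⁻¹' Ici c) :=
    isCompact_Icc.of_isClosed_subset hclosed inter_subset_left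
  obtain ⟨t, ht, htl⟩ := hcomp.exists_isLeast ⟨r₁, ⟨by linarith, le_rfl⟩, h₁⟩
  refine ⟨t, hsub ht.1, ht.2, fun r hr => ?_⟩
  by_contra! h
  rcases lt_or_ge r δ with h' | h'
  · exact absurd (hδ' ⟨hr.1, h'⟩ : g r < c) (not_lt.2 h)
  · exact absurd (htl ⟨⟨by linarith, hr.2.le.trans ht.1.2⟩, h⟩) (not_le.2 hr.2)

/-- Barrier argument for the phase-plane system satisfied by `y = 2 + (1 - m) r f' / f` and
`z = r² f ^ (1 - m) / C_*`: below the level `z = 1` the orbit stays under the curve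
`y = γ (1 - z)`. -/
theorem le_logistic_barrier {b E β μ γ R : ℝ} {y z : ℝ → ℝ}
    (hz : ∀ r, 0 < r → HasDerivAt z (z r * y r / r) r)
    (hy : ∀ r, 0 < r →
      HasDerivAt y ((E * (1 - z r) - b * y r - β * E * z r * y r - μ * y r ^ 2) / r) r)
    (hzpos : ∀ r, 0 < r → 0 < z r) (hz0 : Tendsto z (𝓝[>] 0) (𝓝 0))
    (hy0 : Tendsto y (𝓝[>] 0) (𝓝 2)) (hγ : 2 ≤ γ) (hq : 0 < b + μ * (2 + γ))
    (hL0 : E ≤ γ * (b + μ * γ)) (hL1 : E ≤ γ * (b + β * E - γ))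
    (hR : ∀ r ∈ Ioo 0 R, z r < 1) : ∀ r ∈ Ioo 0 R, y r ≤ γ * (1 - z r) := by
  set q₀ : ℝ → ℝ := fun r => -γ * z r + b + β * E * z r + μ * (y r + γ * (1 - z r)) with hq₀
  have hzc : ContinuousOn z (Ioi 0) := fun r hr => (hz r hr).continuousAt.continuousWithinAt
  have hyc : ContinuousOn y (Ioi 0) := fun r hr => (hy r hr).continuousAt.continuousWithinAt
  have hqc : ContinuousOn (fun r => q₀ r / r) (Ioi 0) := by
    refine ContinuousOn.div ?_ continuousOn_id fun r hr => (ne_of_gt hr)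
    simp only [hq₀]
    fun_prop
  set h : ℝ → ℝ := fun r => γ * (1 - z r) - y r with hh
  set Q : ℝ → ℝ := fun u => ∫ s in (1 : ℝ)..u, q₀ s / s
  have hQ : ∀ r, 0 < r → HasDerivAt Q (q₀ r / r) r := fun r hr =>
    hasDerivAt_integral_of_continuousOn_Ioi hqc hr
  set L : ℝ → ℝ := fun r =>
    (1 - z r) * ((γ * (b + μ * γ) - E) * (1 - z r) + (γ * (b + β * E - γ) - E) * z r) with hLdef
  have hL : ∀ r ∈ Ioo 0 R, 0 ≤ L r := by
    intro r hr
    have h1 := hR r hr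
    have h2 := hzpos r hr.1
    exact mul_nonneg (by linarith) (add_nonneg (mul_nonneg (by linarith) (by linarith))
      (mul_nonneg (by linarith) h2.le))
  have hhd : ∀ r, 0 < r → HasDerivAt h ((L r - q₀ r * h r) / r) r := by
    intro r hr
    have := (((hz r hr).const_sub 1).const_mul γ).sub (hy r hr)
    refine this.congr_deriv ?_
    simp only [hLdef, hq₀, hh]
    field_simp
    ring
  have hmono : MonotoneOn (fun r => h r * exp (Q r)) (Ioo 0 R) := by
    refine monotoneOn_of_hasDerivAt_nonneg (convex_Ioo 0 R) (g' := fun r => L r / r * exp (Q r))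
      (fun r hr => ?_) fun r hr => ?_
    · refine ((hhd r hr.1).mul (hQ r hr.1).exp).congr_deriv ?_
      have := hr.1.ne'
      field_simp
      ring
    · exact mul_nonneg (div_nonneg (hL r hr) hr.1.le) (exp_pos _).le
  intro r₁ hr₁
  by_contra! hneg
  have hneg₁ : h r₁ < 0 := by simp only [hh]; linarith
  have hneg' : ∀ r ∈ Ioc 0 r₁, h r < 0 := by
    intro r hr
    have h1 := hmono ⟨hr.1, hr.2.trans_lt hr₁.2⟩ hr₁ hr.2
    have h2 : h r₁ * exp (Q r₁) < 0 := mul_neg_of_neg_of_pos hneg₁ (exp_pos _)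
    by_contra! h3
    have := mul_nonneg h3 (exp_pos (Q r)).le
    simp only at h1
    linarith
  have hqlim : Tendsto q₀ (𝓝[>] 0) (𝓝 (b + μ * (2 + γ))) := by
    have : Tendsto q₀ (𝓝[>] 0) (𝓝 (-γ * 0 + b + β * E * 0 + μ * (2 + γ * (1 - 0)))) :=
      (((hz0.const_mul _).add_const _).add (hz0.const_mul _)).add
        ((hy0.add ((hz0.const_sub 1).const_mul γ)).const_mul μ)
    simpa using this
  have hhlim : Tendsto h (𝓝[>] 0) (𝓝 (γ - 2)) := by
    have : Tendsto h (𝓝[>] 0) (𝓝 (γ * (1 - 0) - 2)) := ((hz0.const_sub 1).const_mul γ).sub hy0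
    simpa using this
  obtain ⟨δ, hδ, hδ'⟩ := mem_nhdsGT_iff_exists_Ioo_subset.1 (hqlim.eventually_const_lt hq)
  have hδ : 0 < δ := hδ
  set ρ := min (δ / 2) r₁
  have hρ : 0 < ρ := lt_min (by positivity) hr₁.1
  have hmono' : MonotoneOn h (Ioc 0 ρ) := by
    refine monotoneOn_of_hasDerivAt_nonneg (convex_Ioc 0 ρ)
      (fun r hr => hhd r hr.1) fun r hr => ?_
    have h1 : 0 < q₀ r := hδ' ⟨hr.1, by linarith [hr.2.trans (min_le_left _ _)]⟩
    have h2 := hneg' r ⟨hr.1, hr.2.trans (min_le_right _ _)⟩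
    have h3 := hL r ⟨hr.1, (hr.2.trans (min_le_right _ _)).trans_lt hr₁.2⟩
    exact div_nonneg (by nlinarith) hr.1.le
  have hle : γ - 2 ≤ h ρ := by
    refine le_of_tendsto hhlim ?_
    filter_upwards [Ioc_mem_nhdsGT hρ] with r hr
    exact hmono' hr ⟨hρ, le_rfl⟩ hr.2
  have := hneg' ρ ⟨hρ, min_le_right _ _⟩
  linarith

theorem lt_one_and_pos_of_logistic_barrier {b E β μ γ : ℝ} {y z : ℝ → ℝ}
    (hz : ∀ r, 0 < r → HasDerivAt z (z r * y r / r) r)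
    (hy : ∀ r, 0 < r →
      HasDerivAt y ((E * (1 - z r) - b * y r - β * E * z r * y r - μ * y r ^ 2) / r) r)
    (hzpos : ∀ r, 0 < r → 0 < z r) (hz0 : Tendsto z (𝓝[>] 0) (𝓝 0))
    (hy0 : Tendsto y (𝓝[>] 0) (𝓝 2)) (hE : 0 < E) (hγ : 2 ≤ γ) (hq : 0 < b + μ * (2 + γ))
    (hL0 : E ≤ γ * (b + μ * γ)) (hL1 : E ≤ γ * (b + β * E - γ)) :
    ∀ r, 0 < r → z r < 1 ∧ 0 < y r := by
  have hzc : ContinuousOn z (Ioi 0) := fun r hr => (hz r hr).continuousAt.continuousWithinAt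
  have hyc : ContinuousOn y (Ioi 0) := fun r hr => (hy r hr).continuousAt.continuousWithinAt
  have hz1 : ∀ r, 0 < r → z r < 1 := by
    intro r₁ hr₁
    by_contra! h1
    obtain ⟨t, ht, hzt, hlt⟩ :=
      exists_first_hitting_time hzc (hz0.eventually_lt_const one_pos) hr₁ h1
    have hbar := le_logistic_barrier hz hy hzpos hz0 hy0 hγ hq hL0 hL1 hlt
    have hd : ∀ r, 0 < r → HasDerivAt (fun r => (1 - z r) * r ^ γ)
        ((γ * (1 - z r) - z r * y r) / r * r ^ γ) r := by
      intro r hr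
      refine (((hz r hr).const_sub 1).mul
        (Real.hasDerivAt_rpow_const (p := γ) (Or.inl hr.ne'))).congr_deriv ?_
      rw [rpow_sub_one hr.ne']
      field_simp
      ring
    have hm : MonotoneOn (fun r => (1 - z r) * r ^ γ) (Ioo 0 t) := by
      refine monotoneOn_of_hasDerivAt_nonneg (convex_Ioo 0 t) (fun r hr => hd r hr.1) ?_
      intro r hr
      refine mul_nonneg (div_nonneg ?_ hr.1.le) (rpow_nonneg hr.1.le _)
      have h2 := hlt r hr
      have h3 := hzpos r hr.1
      have h4 := mul_le_mul_of_nonneg_left (hbar r hr) h3.le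
      have h5 : 0 ≤ γ * (1 - z r) * (1 - z r) :=
        mul_nonneg (mul_nonneg (by linarith) (by linarith)) (by linarith)
      nlinarith
    have hc : Tendsto (fun r => (1 - z r) * r ^ γ) (𝓝[<] t) (𝓝 ((1 - z t) * t ^ γ)) :=
      (hd t ht).continuousAt.tendsto.mono_left nhdsWithin_le_nhds
    have hle : (1 - z (t / 2)) * (t / 2) ^ γ ≤ (1 - z t) * t ^ γ := by
      refine ge_of_tendsto hc ?_
      filter_upwards [Ioo_mem_nhdsLT (half_lt_self ht)] with r hr
      exact hm ⟨by positivity, half_lt_self ht⟩ ⟨by linarith [hr.1], hr.2⟩ hr.1.le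
    have h6 : 0 < (1 - z (t / 2)) * (t / 2) ^ γ :=
      mul_pos (by linarith [hlt (t / 2) ⟨by positivity, half_lt_self ht⟩])
        (rpow_pos_of_pos (by positivity) _)
    have h7 : (1 - z t) * t ^ γ ≤ 0 :=
      mul_nonpos_of_nonpos_of_nonneg (by linarith) (rpow_nonneg ht.le _)
    linarith
  refine fun r hr => ⟨hz1 r hr, ?_⟩
  by_contra! hyr
  obtain ⟨t, ht, hyt, hlt⟩ := exists_first_hitting_time (g := fun r => -y r) (c := 0) hyc.neg
    (by filter_upwards [hy0.eventually_const_lt two_pos] with s hs; linarith) hr (by linarith)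
  have hyt0 : y t = 0 := by
    refine le_antisymm (by linarith) ?_
    have hc : Tendsto y (𝓝[<] t) (𝓝 (y t)) :=
      (hy t ht).continuousAt.tendsto.mono_left nhdsWithin_le_nhds
    refine ge_of_tendsto hc ?_
    filter_upwards [Ioo_mem_nhdsLT ht] with s hs
    linarith [hlt s hs]
  have hd := hy t ht
  simp only [hyt0] at hd
  have hpos : 0 < (E * (1 - z t) - b * 0 - β * E * z t * 0 - μ * 0 ^ 2) / t := by
    have := mul_pos hE (sub_pos.2 (hz1 t ht))
    apply div_pos _ ht
    linarith
  have hslope := hd.tendsto_slope.mono_left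
    (nhdsWithin_mono t (s := Iio t) (fun x hx => ne_of_lt hx))
  obtain ⟨s, hs1, hs2⟩ :=
    ((hslope.eventually_const_lt hpos).and (Ioo_mem_nhdsLT ht)).exists
  have h8 := hlt s hs2
  rw [slope_def_field, hyt0] at hs1
  have : (y s - 0) / (s - t) < 0 := div_neg_of_pos_of_neg (by linarith) (by linarith [hs2.2])
  linarith

theorem nonneg_of_hasDerivAt_nonneg_of_tendsto_zero {G G' : ℝ → ℝ}
    (hG : ∀ r, 0 < r → HasDerivAt G (G' r) r) (hG' : ∀ r, 0 < r → 0 ≤ G' r)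
    (h0 : Tendsto G (𝓝[>] 0) (𝓝 0)) {r : ℝ} (hr : 0 < r) : 0 ≤ G r := by
  have hm := monotoneOn_of_hasDerivAt_nonneg (convex_Ioi 0) hG hG'
  refine le_of_tendsto h0 ?_
  filter_upwards [Ioc_mem_nhdsGT hr] with s hs
  exact hm hs.1 hr hs.2

theorem exists_pos_le_of_hasDerivAt_pos_of_tendsto_zero {G G' : ℝ → ℝ}
    (hG : ∀ r, 0 < r → HasDerivAt G (G' r) r) (hG' : ∀ r, 0 < r → 0 < G' r)
    (h0 : Tendsto G (𝓝[>] 0) (𝓝 0)) : ∃ c, 0 < c ∧ ∀ r, 1 ≤ r → c ≤ G r := by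
  have hm : StrictMonoOn G (Ioi 0) := by
    refine strictMonoOn_of_deriv_pos (convex_Ioi 0)
      (fun x hx => (hG x hx).continuousAt.continuousWithinAt) fun x hx => ?_
    rw [interior_Ioi] at hx
    rw [(hG x hx).deriv]
    exact hG' x hx
  have h1 : 0 ≤ G (1 / 2) := nonneg_of_hasDerivAt_nonneg_of_tendsto_zero hG
    (fun r hr => (hG' r hr).le) h0 (by norm_num)
  have h2 : G (1 / 2) < G 1 := hm (by norm_num) (by norm_num) (by norm_num)
  exact ⟨G 1, by linarith, fun r hr =>
    hm.monotoneOn (by norm_num) (zero_lt_one.trans_le hr) hr⟩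

/-- A flux identity `(r ^ (k + 2) v' + β r ^ (k + 3) u)' = κ r ^ (k + 2) u` for positive `u`, `v`
with `v` dominated by `r ^ 2 u` prevents `r ^ (k + 2) u` from being integrable. -/
theorem not_integrableOn_of_flux {k : ℕ} {β κ C : ℝ} {u v v' : ℝ → ℝ}
    (hu : ∀ r, 0 < r → 0 < u r) (huc : ContinuousOn u (Ioi 0))
    (hv : ∀ r, 0 < r → HasDerivAt v (v' r) r) (hvpos : ∀ r, 0 < r → 0 < v r)
    (hflux : ∀ r, 0 < r → HasDerivAt (fun s => s ^ (k + 2) * v' s + β * (s ^ (k + 3) * u s))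
      (κ * (r ^ (k + 2) * u r)) r)
    (hflux0 : Tendsto (fun s => s ^ (k + 2) * v' s + β * (s ^ (k + 3) * u s)) (𝓝[>] 0) (𝓝 0))
    (hC : ∀ r, 1 ≤ r → v r ≤ C * (r ^ 2 * u r))
    (hκ : κ = 0 → ∀ r, 1 ≤ r → β * (r ^ 2 * u r) ≤ (k + 1) * v r) :
    ¬ IntegrableOn (fun r => r ^ (k + 2) * u r) (Ioi 0) := by
  intro h_int
  have hC0 : 0 < C := by
    have h1 := hC 1 le_rfl
    have h2 := hvpos 1 one_pos
    have h3 := hu 1 one_pos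
    by_contra! h4
    nlinarith
  have hno : ¬ ∃ c, 0 < c ∧ ∀ᶠ r in atTop, c ≤ r ^ (k + 1) * v r := by
    rintro ⟨c, hc, hev⟩
    obtain ⟨R, hR'⟩ := eventually_atTop.1 ((eventually_ge_atTop (1 : ℝ)).and hev)
    have hR1 : 1 ≤ R := (hR' R le_rfl).1
    have hR : ∀ r, R ≤ r → c ≤ r ^ (k + 1) * v r := fun r hr => (hR' r hr).2
    refine not_integrableOn_Ioi_inv (a := R) ?_
    have h_int' : IntegrableOn (fun r => C / c * (r ^ (k + 2) * u r)) (Ioi R) :=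
      (h_int.mono_set (Ioi_subset_Ioi (by linarith))).const_mul _
    refine Integrable.mono' h_int' (by fun_prop) ?_
    refine (ae_restrict_mem measurableSet_Ioi).mono fun r hr => ?_
    have hr : R < r := hr
    have hr0 : 0 < r := by linarith
    rw [Real.norm_of_nonneg (by positivity)]
    have h1 := hR r hr.le
    have h2 := mul_le_mul_of_nonneg_left (hC r (by linarith)) (pow_nonneg hr0.le (k + 1))
    rw [inv_eq_one_div, div_mul_eq_mul_div, div_le_div_iff₀ hr0 hc]
    calc 1 * c ≤ r ^ (k + 1) * (C * (r ^ 2 * u r)) := by linarith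
      _ = C * (r ^ (k + 2) * u r) * r := by ring
  have hgc : ContinuousOn (fun r => r ^ (k + 2) * u r) (Ioi 0) :=
    (continuousOn_pow _).mul huc
  set J : ℝ → ℝ := fun r => ∫ s in (1 : ℝ)..r, s ^ (k + 2) * u s
  have hJ : ∀ r, 0 < r → HasDerivAt J (r ^ (k + 2) * u r) r := fun r hr =>
    hasDerivAt_integral_of_continuousOn_Ioi hgc hr
  set I : ℝ := ∫ s in Ioi 0, s ^ (k + 2) * u s
  have hgpos : ∀ r, 0 < r → 0 < r ^ (k + 2) * u r := fun r hr =>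
    mul_pos (pow_pos hr _) (hu r hr)
  have hJI : ∀ r, 1 ≤ r → |J r| ≤ I := by
    intro r hr
    have h1 : J r = ∫ s in Ioc 1 r, s ^ (k + 2) * u s := intervalIntegral.integral_of_le hr
    have hnn : 0 ≤ᵐ[volume.restrict (Ioi 0)] fun s => s ^ (k + 2) * u s :=
      (ae_restrict_mem measurableSet_Ioi).mono fun s hs => (hgpos s hs).le
    have hsub : Ioc 1 r ⊆ Ioi (0 : ℝ) := fun s hs => one_pos.trans hs.1
    rw [h1, abs_of_nonneg]
    · exact setIntegral_mono_set h_int hnn hsub.eventuallyLE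
    · exact setIntegral_nonneg measurableSet_Ioc fun s hs => (hgpos s (hsub hs)).le
  have hlog : ∀ c, 0 < c → ∀ a : ℝ, ∀ᶠ r in atTop, a ≤ c * log r := fun c hc a =>
    (tendsto_log_atTop.const_mul_atTop hc).eventually_ge_atTop a
  have hpv : ∀ r, 0 < r → HasDerivAt (fun r => r ^ (k + 1) * v r)
      ((k + 1) * (r ^ k * v r) + r ^ (k + 1) * v' r) r := by
    intro r hr
    refine ((hasDerivAt_pow (k + 1) r).mul (hv r hr)).congr_deriv ?_
    simp only [Nat.add_sub_cancel]
    push_cast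
    ring
  rcases lt_trichotomy κ 0 with hκ0 | hκ0 | hκ0
  · obtain ⟨c, hc, hcG⟩ := exists_pos_le_of_hasDerivAt_pos_of_tendsto_zero
      (fun r hr => (hflux r hr).neg) (fun r hr => by nlinarith [hgpos r hr])
      (by have h := hflux0.neg; rwa [neg_zero] at h)
    have hm : MonotoneOn
        (fun r => ((k + 1) * C - β) * J r - r ^ (k + 1) * v r - c * log r) (Ici 1) := by
      refine monotoneOn_of_hasDerivAt_nonneg (convex_Ici 1) (g' := fun r =>
        ((k + 1) * C - β) * (r ^ (k + 2) * u r)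
          - ((k + 1) * (r ^ k * v r) + r ^ (k + 1) * v' r) - c * r⁻¹) (fun r hr => ?_)
        fun r hr => ?_
      · have hr0 : 0 < r := one_pos.trans_le hr
        exact (((hJ r hr0).const_mul _).sub (hpv r hr0)).sub
          ((hasDerivAt_log hr0.ne').const_mul c)
      · have hr0 : 0 < r := one_pos.trans_le hr
        have h1 : c ≤ -(r ^ (k + 2) * v' r + β * (r ^ (k + 3) * u r)) := hcG r hr
        have h2 := mul_le_mul_of_nonneg_left (hC r hr) (pow_nonneg hr0.le k)
        have h3 : 0 ≤ (k + 1 : ℝ) * (r ^ k * (C * (r ^ 2 * u r)) - r ^ k * v r) :=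
          mul_nonneg (by positivity) (by linarith)
        have h4 : 0 ≤ (-(r ^ (k + 2) * v' r + β * (r ^ (k + 3) * u r)) - c) / r :=
          div_nonneg (by linarith) hr0.le
        have h5 : (-(r ^ (k + 2) * v' r + β * (r ^ (k + 3) * u r)) - c) / r
            = -(r ^ (k + 1) * v' r) - β * (r ^ (k + 2) * u r) - c * r⁻¹ := by
          field_simp
          ring
        rw [h5] at h4
        calc 0 ≤ (k + 1 : ℝ) * (r ^ k * (C * (r ^ 2 * u r)) - r ^ k * v r) +
              (-(r ^ (k + 1) * v' r) - β * (r ^ (k + 2) * u r) - c * r⁻¹) := by linarith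
          _ = _ := by ring
    obtain ⟨r, hr, hr1⟩ := ((hlog c hc (|(k + 1) * C - β| * I
      - (((k + 1) * C - β) * J 1 - 1 ^ (k + 1) * v 1 - c * log 1))).and
      (eventually_ge_atTop 1)).exists
    have h1 := hm (mem_Ici.2 le_rfl) hr1 hr1
    simp only at h1
    have h2 : ((k + 1) * C - β) * J r ≤ |(k + 1) * C - β| * I := by
      refine (le_abs_self _).trans ?_
      rw [abs_mul]
      exact mul_le_mul_of_nonneg_left (hJI r hr1) (abs_nonneg _)
    have h3 : 0 < r ^ (k + 1) * v r := by
      have := hvpos r (by linarith)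
      positivity
    linarith
  · have hG0 : ∀ r, 0 < r → r ^ (k + 2) * v' r + β * (r ^ (k + 3) * u r) = 0 := by
      intro r hr
      refine le_antisymm ?_ ?_
      · exact neg_nonneg.1 (nonneg_of_hasDerivAt_nonneg_of_tendsto_zero
          (fun r hr => (hflux r hr).neg) (fun r hr => by simp [hκ0]) (by have h := hflux0.neg; rwa [neg_zero] at h) hr)
      · exact nonneg_of_hasDerivAt_nonneg_of_tendsto_zero hflux
          (fun r hr => by simp [hκ0]) hflux0 hr
    have hm : MonotoneOn (fun r => r ^ (k + 1) * v r) (Ici 1) := by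
      refine monotoneOn_of_hasDerivAt_nonneg (convex_Ici 1)
        (fun r hr => hpv r (one_pos.trans_le hr)) fun r hr => ?_
      have hr0 : 0 < r := one_pos.trans_le hr
      have h1 : r ^ (k + 1) * v' r = -(r ^ k * (β * (r ^ 2 * u r))) := by
        have h2 := hG0 r hr0
        have h3 : r * (r ^ (k + 1) * v' r + r ^ k * (β * (r ^ 2 * u r))) = 0 := by
          rw [← h2]; ring
        have h4 := (mul_eq_zero.1 h3).resolve_left hr0.ne'
        linarith
      have h5 := mul_le_mul_of_nonneg_left (hκ hκ0 r hr) (pow_nonneg hr0.le k)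
      rw [h1]
      linarith
    refine hno ⟨v 1, hvpos 1 one_pos, ?_⟩
    filter_upwards [eventually_ge_atTop 1] with r hr
    have := hm (mem_Ici.2 le_rfl) hr hr
    simpa using this
  · obtain ⟨c, hc, hcG⟩ := exists_pos_le_of_hasDerivAt_pos_of_tendsto_zero
      hflux (fun r hr => mul_pos hκ0 (hgpos r hr)) hflux0
    have hm : MonotoneOn
        (fun r => r ^ (k + 1) * v r + β * J r - c * log r) (Ici 1) := by
      refine monotoneOn_of_hasDerivAt_nonneg (convex_Ici 1) (g' := fun r =>
        ((k + 1) * (r ^ k * v r) + r ^ (k + 1) * v' r) + β * (r ^ (k + 2) * u r)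
          - c * r⁻¹) (fun r hr => ?_) fun r hr => ?_
      · have hr0 : 0 < r := one_pos.trans_le hr
        exact ((hpv r hr0).add ((hJ r hr0).const_mul _)).sub
          ((hasDerivAt_log hr0.ne').const_mul c)
      · have hr0 : 0 < r := one_pos.trans_le hr
        have h1 : c ≤ r ^ (k + 2) * v' r + β * (r ^ (k + 3) * u r) := hcG r hr
        have h3 : 0 ≤ (k + 1 : ℝ) * (r ^ k * v r) := by
          have := hvpos r hr0
          positivity
        have h4 : 0 ≤ (r ^ (k + 2) * v' r + β * (r ^ (k + 3) * u r) - c) / r :=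
          div_nonneg (by linarith) hr0.le
        have h5 : (r ^ (k + 2) * v' r + β * (r ^ (k + 3) * u r) - c) / r
            = r ^ (k + 1) * v' r + β * (r ^ (k + 2) * u r) - c * r⁻¹ := by
          field_simp
          ring
        rw [h5] at h4
        linarith
    refine hno ⟨1, one_pos, ?_⟩
    filter_upwards [hlog c hc (1 + |β| * I
      - (1 ^ (k + 1) * v 1 + β * J 1 - c * log 1)), eventually_ge_atTop 1] with r hr hr1
    have h1 := hm (mem_Ici.2 le_rfl) hr1 hr1
    simp only at h1
    have h2 : β * J r ≤ |β| * I := by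
      refine (le_abs_self _).trans ?_
      rw [abs_mul]
      exact mul_le_mul_of_nonneg_left (hJI r hr1) (abs_nonneg _)
    linarith

/-- The tangent-line inequality for the concave power function. -/
theorem rpow_le_rpow_add_mul_sub {m x y : ℝ} (hm0 : 0 < m) (hm1 : m ≤ 1) (hx : 0 < x)
    (hy : 0 < y) : y ^ m ≤ x ^ m + m * x ^ (m - 1) * (y - x) := by
  have h := rpow_one_add_le_one_add_mul_self (s := (y - x) / x) (p := m)
    (by rw [le_div_iff₀ hx]; linarith) hm0.le hm1
  have h1 : 1 + (y - x) / x = y / x := by field_simp; ring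
  rw [h1, div_rpow hy.le hx.le, div_le_iff₀ (rpow_pos_of_pos hx m)] at h
  rw [rpow_sub_one hx.ne']
  calc y ^ m ≤ _ := h
    _ = _ := by ring

namespace IsProfile

variable {n : ℕ} {m β α lam : ℝ} {f : ℝ → ℝ}

theorem hasDerivAt (p : IsProfile n m β α lam f) {r : ℝ} (hr : 0 < r) :
    HasDerivAt f (deriv f r) r :=
  ((p.smooth.contDiffAt (Ici_mem_nhds hr)).differentiableAt (by norm_num)).hasDerivAt

theorem hasDerivAt_deriv (p : IsProfile n m β α lam f) {r : ℝ} (hr : 0 < r) :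
    HasDerivAt (deriv f) (deriv (deriv f) r) r := by
  have h := (p.smooth.mono Ioi_subset_Ici_self).deriv_of_isOpen (m := 1) isOpen_Ioi (by norm_num)
  exact ((h.contDiffAt (Ioi_mem_nhds hr)).differentiableAt (by norm_num)).hasDerivAt

theorem hasDerivAt_rpow (p : IsProfile n m β α lam f) (q : ℝ) {r : ℝ} (hr : 0 < r) :
    HasDerivAt (fun s => f s ^ q) (deriv f r * q * f r ^ (q - 1)) r :=
  (p.hasDerivAt hr).rpow_const (Or.inl (p.pos r hr.le).ne')

theorem hasDerivAt_deriv_rpow (p : IsProfile n m β α lam f) {r : ℝ} (hr : 0 < r) :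
    HasDerivAt (deriv fun s => f s ^ m)
      (deriv (deriv f) r * m * f r ^ (m - 1)
        + deriv f r * m * (deriv f r * (m - 1) * f r ^ (m - 1 - 1))) r := by
  have h := ((p.hasDerivAt_deriv hr).mul_const m).mul (p.hasDerivAt_rpow (m - 1) hr)
  refine h.congr_of_eventuallyEq ?_
  filter_upwards [Ioi_mem_nhds hr] with s hs
  exact (p.hasDerivAt_rpow m hs).deriv

theorem tendsto_zero (p : IsProfile n m β α lam f) : Tendsto f (𝓝[>] 0) (𝓝 (f 0)) :=
  (p.smooth.continuousOn 0 (mem_Ici.2 le_rfl)).mono_left (nhdsWithin_mono 0 Ioi_subset_Ici_self)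

theorem tendsto_deriv_zero (p : IsProfile n m β α lam f) :
    ∃ c, Tendsto (deriv f) (𝓝[>] 0) (𝓝 c) := by
  have h := p.smooth.continuousOn_derivWithin (uniqueDiffOn_Ici 0) (by norm_num)
  refine ⟨derivWithin f (Ici 0) 0, ?_⟩
  refine ((h 0 (mem_Ici.2 le_rfl)).mono_left (nhdsWithin_mono 0 Ioi_subset_Ici_self)).congr' ?_
  filter_upwards [self_mem_nhdsWithin] with s hs
  exact derivWithin_of_mem_nhds (Ici_mem_nhds hs)

/-- The profile equation in divergence form. -/
theorem hasDerivAt_flux {k : ℕ} (p : IsProfile (k + 3) m β α lam f) {r : ℝ} (hr : 0 < r) :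
    HasDerivAt (fun s => s ^ (k + 2) * (deriv f s * m * f s ^ (m - 1)) + β * (s ^ (k + 3) * f s))
      (((k + 3) * β - α) * (r ^ (k + 2) * f r)) r := by
  have hV := p.hasDerivAt_deriv_rpow hr
  have hode := p.ode r hr
  rw [hV.deriv, (p.hasDerivAt_rpow m hr).deriv] at hode
  have hV' : HasDerivAt (fun s => deriv f s * m * f s ^ (m - 1)) _ r :=
    hV.congr_of_eventuallyEq (by
      filter_upwards [Ioi_mem_nhds hr] with s hs
      exact (p.hasDerivAt_rpow m hs).deriv.symm)
  refine (((hasDerivAt_pow (k + 2) r).mul hV').add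
    (((hasDerivAt_pow (k + 3) r).mul (p.hasDerivAt hr)).const_mul β)).congr_deriv ?_
  set V := deriv f r * m * f r ^ (m - 1)
  set W := deriv (deriv f) r * m * f r ^ (m - 1)
        + deriv f r * m * (deriv f r * (m - 1) * f r ^ (m - 1 - 1))
  have hW : W = -((k + 2) / r * V) - α * f r - β * r * deriv f r := by
    push_cast at hode
    have : ((k : ℝ) + 3 - 1) = k + 2 := by ring
    rw [this] at hode
    linarith
  rw [hW]
  push_cast
  field_simp
  ring

theorem tendsto_flux_zero {k : ℕ} (p : IsProfile (k + 3) m β α lam f) :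
    Tendsto (fun s => s ^ (k + 2) * (deriv f s * m * f s ^ (m - 1)) + β * (s ^ (k + 3) * f s))
      (𝓝[>] 0) (𝓝 0) := by
  obtain ⟨c, hc⟩ := p.tendsto_deriv_zero
  have hp : ∀ j : ℕ, Tendsto (fun s : ℝ => s ^ (j + 1)) (𝓝[>] 0) (𝓝 0) := fun j => by
    have := ((continuous_pow (j + 1)).tendsto (0 : ℝ)).mono_left
      (nhdsWithin_le_nhds (s := Ioi 0))
    simpa using this
  have h1 := (hp (k + 1)).mul ((hc.mul_const m).mul
    (p.tendsto_zero.rpow_const (p := m - 1) (Or.inl (p.pos 0 le_rfl).ne')))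
  have h2 := ((hp (k + 2)).mul p.tendsto_zero).const_mul β
  simpa using h1.add h2

/-- The logarithmic slope `2 + (1 - m) r f' / f` of `r ^ 2 f ^ (1 - m)` solves a first-order
equation. -/
theorem hasDerivAt_logSlope (p : IsProfile n m β α lam f) (hm0 : 0 < m) (hm1 : m < 1)
    (hα : α = (2 * β + 1) / (1 - m)) {K : ℝ} (hK : 0 < K) {r : ℝ} (hr : 0 < r) :
    HasDerivAt (fun s => 2 + (1 - m) * (s * deriv f s / f s))
      ((-(n - 2) * ((2 + (1 - m) * (r * deriv f r / f r)) - 2)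
        - m / (1 - m) * ((2 + (1 - m) * (r * deriv f r / f r)) - 2) ^ 2
        - K / m * (r ^ 2 * f r ^ (1 - m) / K)
          * (1 + β * (2 + (1 - m) * (r * deriv f r / f r)))) / r) r := by
  have hfr := p.pos r hr.le
  have hode := p.ode r hr
  rw [(p.hasDerivAt_deriv_rpow hr).deriv, (p.hasDerivAt_rpow m hr).deriv] at hode
  refine ((((hasDerivAt_id r).mul (p.hasDerivAt_deriv hr)).div (p.hasDerivAt hr)
    hfr.ne').const_mul (1 - m)).const_add 2 |>.congr_deriv ?_
  have hm1' : (1 - m) ≠ 0 := by linarith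
  have e1 : f r ^ (m - 1 - 1) = f r ^ (m - 1) / f r := rpow_sub_one hfr.ne' _
  have e2 : f r ^ (1 - m) = (f r ^ (m - 1))⁻¹ := by
    rw [← rpow_neg hfr.le]; congr 1; ring
  have hX : 0 < f r ^ (m - 1) := rpow_pos_of_pos hfr _
  rw [e1] at hode
  rw [e2]
  simp only [Pi.mul_apply, id]
  subst hα
  generalize f r ^ (m - 1) = X at *
  generalize deriv (deriv f) r = F2 at *
  generalize deriv f r = F1 at *
  generalize f r = F at *
  have hF2 : F2 = (-(F1 * m * (F1 * (m - 1) * (X / F))) - (n - 1) / r * (F1 * m * X)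
      - (2 * β + 1) / (1 - m) * F - β * r * F1) / (m * X) := by
    rw [eq_div_iff (by positivity)]
    linarith
  rw [hF2]
  field_simp
  ring

theorem hasDerivAt_scaled (p : IsProfile n m β α lam f) {K r : ℝ} (hr : 0 < r) :
    HasDerivAt (fun s => s ^ 2 * f s ^ (1 - m) / K)
      (r ^ 2 * f r ^ (1 - m) / K * (2 + (1 - m) * (r * deriv f r / f r)) / r) r := by
  have hfr := p.pos r hr.le
  refine (((hasDerivAt_pow 2 r).mul (p.hasDerivAt_rpow (1 - m) hr)).div_const K).congr_deriv ?_
  rw [rpow_sub_one hfr.ne']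
  field_simp
  ring

end IsProfile

theorem lt_one_of_lt_sub_two_div {n : ℕ} {m : ℝ} (hn : 3 ≤ n) (hm1 : m < ((n : ℝ) - 2) / n) :
    m < 1 ∧ 0 < (n : ℝ) - 2 - n * m := by
  have hn' : (3 : ℝ) ≤ n := by exact_mod_cast hn
  rw [lt_div_iff₀ (by linarith)] at hm1
  exact ⟨by by_contra! h; nlinarith, by linarith⟩

theorem CondC1.cases {n : ℕ} {m β : ℝ} (hm0 : 0 < m) (hm1 : m < 1)
    (hD : 0 < (n : ℝ) - 2 - n * m) (h : CondC1 n m β) :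
    1 < β * ((n : ℝ) - 2 - n * m) ∨
      (2 * (1 - m) < (n : ℝ) - 2 - n * m ∧ β * ((n : ℝ) - 2 - n * m) ≤ 1 ∧
        2 * √(2 * ((n : ℝ) - 2 - n * m) * (1 - m)) < A0 n m β) := by
  rcases h with h | ⟨h4, -, h5, h6, h7⟩
  · left
    rw [beta1, div_lt_iff₀ hD] at h
    exact h
  · right
    have hn' : (4 : ℝ) < n := by exact_mod_cast h4
    rw [lt_div_iff₀ (by linarith)] at h5
    rw [beta1, le_div_iff₀ hD] at h7
    have h8 : beta2 n m < β := (le_max_left _ _).trans_lt h6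
    refine ⟨by linarith, h7, ?_⟩
    have h9 := mul_lt_mul_of_pos_right h8 (mul_pos two_pos hD)
    have h10 : √(2 * ((n : ℝ) - 2 - n * m) * (1 - m)) =
        √(2 * (1 - m) / ((n : ℝ) - 2 - n * m)) * ((n : ℝ) - 2 - n * m) := by
      rw [show 2 * ((n : ℝ) - 2 - n * m) * (1 - m) =
        2 * (1 - m) / ((n : ℝ) - 2 - n * m) * ((n : ℝ) - 2 - n * m) ^ 2 by field_simp,
        sqrt_mul (div_nonneg (by linarith) hD.le), sqrt_sq hD.le]
    rw [beta2] at h9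
    have h11 : (((n : ℝ) + 2) * m - ((n : ℝ) - 2)) / (2 * ((n : ℝ) - 2 - n * m)) *
        (2 * ((n : ℝ) - 2 - n * m)) = ((n : ℝ) + 2) * m - ((n : ℝ) - 2) := by field_simp
    rw [add_mul, h11] at h9
    rw [h10, A0]
    linarith

theorem CondC1.gamma1_lt {n : ℕ} {m β : ℝ} (hm0 : 0 < m) (hm1 : m < 1)
    (hD : 0 < (n : ℝ) - 2 - n * m) (h : CondC1 n m β) :
    0 < (n : ℝ) - 2 / (1 - m) - gamma1 n m β := by
  have hA : A0 n m β = ((n : ℝ) - 2 - n * m) - 2 * m + 2 * (β * ((n : ℝ) - 2 - n * m)) := by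
    rw [A0]; ring
  have key : A0 n m β - 2 * ((n : ℝ) - 2 - n * m) <
      √((A0 n m β) ^ 2 - 8 * ((n : ℝ) - 2 - n * m) * (1 - m)) := by
    set D := (n : ℝ) - 2 - n * m with hDdef
    by_cases h0 : A0 n m β - 2 * D < 0
    · exact h0.trans_le (sqrt_nonneg _)
    · rw [not_lt] at h0
      refine lt_sqrt_of_sq_lt ?_
      have h1 : D + 2 * (1 - m) < A0 n m β := by
        rcases h.cases hm0 hm1 hD with h2 | ⟨h2, -, -⟩
        · rw [hA]; linarith
        · linarith
      nlinarith [mul_lt_mul_of_pos_left h1 hD]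
  have ht : 0 < 1 - m := by linarith
  have : (n : ℝ) - 2 / (1 - m) - gamma1 n m β =
      (2 * ((n : ℝ) - 2 - n * m) - A0 n m β +
        √((A0 n m β) ^ 2 - 8 * ((n : ℝ) - 2 - n * m) * (1 - m))) / (2 * (1 - m)) := by
    rw [gamma1]
    field_simp
    ring
  rw [this]
  exact div_pos (by linarith) (by linarith)

/-- Under (C1) there is an admissible slope for the logistic barrier. -/
theorem CondC1.exists_barrier_slope {n : ℕ} {m β : ℝ} (hm0 : 0 < m) (hm1 : m < 1)
    (hD : 0 < (n : ℝ) - 2 - n * m) (h : CondC1 n m β) :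
    ∃ γ : ℝ, 2 ≤ γ ∧ 2 * ((n : ℝ) - 2 - n * m) / (1 - m) ≤
      γ * ((n : ℝ) - 2 - 4 * m / (1 - m) + β * (2 * ((n : ℝ) - 2 - n * m) / (1 - m)) - γ) := by
  have ht : 0 < 1 - m := by linarith
  have hA : (n : ℝ) - 2 - 4 * m / (1 - m) + β * (2 * ((n : ℝ) - 2 - n * m) / (1 - m)) =
      A0 n m β / (1 - m) := by
    rw [A0]
    field_simp
    ring
  rw [hA]
  rcases h.cases hm0 hm1 hD with h2 | ⟨h2, -, h3⟩
  · refine ⟨2, le_rfl, ?_⟩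
    rw [div_le_iff₀ ht]
    have h4 : 2 * (A0 n m β / (1 - m) - 2) * (1 - m) = 2 * A0 n m β - 4 * (1 - m) := by
      field_simp
      ring
    rw [h4, A0]
    linarith
  · set E := 2 * ((n : ℝ) - 2 - n * m) / (1 - m) with hE
    have hE4 : 4 ≤ E := by rw [hE, le_div_iff₀ ht]; linarith
    have hs : √(2 * ((n : ℝ) - 2 - n * m) * (1 - m)) = √E * (1 - m) := by
      rw [show 2 * ((n : ℝ) - 2 - n * m) * (1 - m) = E * (1 - m) ^ 2 by rw [hE]; field_simp,
        sqrt_mul (by linarith), sqrt_sq ht.le]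
    have hE0 : √E * √E = E := mul_self_sqrt (by linarith)
    have h5 : 2 * √E ≤ A0 n m β / (1 - m) := by
      rw [le_div_iff₀ ht]
      rw [hs] at h3
      linarith
    refine ⟨√E, le_sqrt_of_sq_le (by linarith), ?_⟩
    have := mul_le_mul_of_nonneg_left h5 (sqrt_nonneg E)
    linarith

/-- Under (C1), `r ^ 2 f ^ (1 - m)` stays below `C_*` and has positive logarithmic slope. -/
theorem IsProfile.scaled_lt_and_logSlope_pos {n : ℕ} {m β α lam : ℝ} {f : ℝ → ℝ} (hn : 3 ≤ n)
    (hm0 : 0 < m) (hm1 : m < ((n : ℝ) - 2) / n) (hα : α = (2 * β + 1) / (1 - m))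
    (hC1 : CondC1 n m β) (p : IsProfile n m β α lam f) {r : ℝ} (hr : 0 < r) :
    r ^ 2 * f r ^ (1 - m) / Cstar n m < 1 ∧ 0 < 2 + (1 - m) * (r * deriv f r / f r) := by
  obtain ⟨hm1', hD⟩ := lt_one_of_lt_sub_two_div hn hm1
  have hn' : (3 : ℝ) ≤ n := by exact_mod_cast hn
  have ht : 0 < 1 - m := by linarith
  have hK : 0 < Cstar n m := by rw [Cstar]; positivity
  have hKm : Cstar n m / m = 2 * ((n : ℝ) - 2 - n * m) / (1 - m) := by
    rw [Cstar]; field_simp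
  obtain ⟨γ, hγ, hL1⟩ := hC1.exists_barrier_slope hm0 hm1' hD
  have hid : Tendsto (fun s : ℝ => s) (𝓝[>] 0) (𝓝 0) := tendsto_id.mono_left nhdsWithin_le_nhds
  have hb : 0 < ((n : ℝ) - 2 - 4 * m / (1 - m)) + m / (1 - m) * (2 + γ) := by
    have h1 : 0 ≤ m / (1 - m) * (γ - 2) := mul_nonneg (by positivity) (by linarith)
    have h2 : ((n : ℝ) - 2 - 4 * m / (1 - m)) + m / (1 - m) * (2 + γ)
        = n - 2 + m / (1 - m) * (γ - 2) := by ring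
    linarith
  have hE2 : 2 * ((n : ℝ) - 2 - n * m) / (1 - m) = 2 * (n - 2) - 4 * m / (1 - m) := by
    field_simp
    ring
  refine lt_one_and_pos_of_logistic_barrier (E := 2 * ((n : ℝ) - 2 - n * m) / (1 - m))
    (b := (n : ℝ) - 2 - 4 * m / (1 - m)) (β := β) (μ := m / (1 - m)) (γ := γ)
    (y := fun s => 2 + (1 - m) * (s * deriv f s / f s))
    (z := fun s => s ^ 2 * f s ^ (1 - m) / Cstar n m)
    (fun s hs => p.hasDerivAt_scaled hs) (fun s hs => ?_) (fun s hs => ?_) ?_ ?_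
    (by positivity) hγ hb ?_ hL1 r hr
  · refine (p.hasDerivAt_logSlope hm0 hm1' hα hK hs).congr_deriv ?_
    rw [hKm, hE2]
    ring
  · have := p.pos s hs.le
    positivity
  · have h := (((hid.pow 2).mul (p.tendsto_zero.rpow_const (p := 1 - m)
      (Or.inl (p.pos 0 le_rfl).ne'))).div_const (Cstar n m))
    simpa using h
  · obtain ⟨c, hc⟩ := p.tendsto_deriv_zero
    have h := (((hid.mul hc).div p.tendsto_zero (p.pos 0 le_rfl).ne').const_mul
      (1 - m)).const_add 2
    simpa using h
  · have h1 : 0 ≤ (γ - 2) * (((n : ℝ) - 2 - 4 * m / (1 - m)) + m / (1 - m) * (2 + γ)) :=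
      mul_nonneg (by linarith) hb.le
    rw [hE2]
    calc _ ≤ 2 * (n - 2) - 4 * m / (1 - m) +
          (γ - 2) * (((n : ℝ) - 2 - 4 * m / (1 - m)) + m / (1 - m) * (2 + γ)) := by linarith
      _ = _ := by ring

theorem IsProfile.strictMonoOn_scaled {n : ℕ} {m β α lam : ℝ} {f : ℝ → ℝ} (hn : 3 ≤ n)
    (hm0 : 0 < m) (hm1 : m < ((n : ℝ) - 2) / n) (hα : α = (2 * β + 1) / (1 - m))
    (hC1 : CondC1 n m β) (p : IsProfile n m β α lam f) :
    StrictMonoOn (fun r => r ^ 2 * f r ^ (1 - m)) (Ioi 0) := by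
  refine strictMonoOn_of_deriv_pos (convex_Ioi 0) (fun r hr => ?_) fun r hr => ?_
  · have h := (p.hasDerivAt_scaled (K := 1) hr).continuousAt.continuousWithinAt (s := Ioi 0)
    simpa only [div_one] using h
  · rw [interior_Ioi] at hr
    have hr : 0 < r := hr
    have h := p.hasDerivAt_scaled (K := 1) hr
    simp only [div_one] at h
    rw [h.deriv]
    have h1 := (p.scaled_lt_and_logSlope_pos hn hm0 hm1 hα hC1 hr).2
    have h2 := p.pos r hr.le
    positivity

/-- Profiles with larger parameter lie strictly above. -/
theorem profile_lt_of_lt {n : ℕ} {m β α : ℝ} {f : ℝ → ℝ → ℝ} (hn : 3 ≤ n)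
    (hm0 : 0 < m) (hm1 : m < ((n : ℝ) - 2) / n) (hα : α = (2 * β + 1) / (1 - m))
    (hC1 : CondC1 n m β) (hf : ∀ lam, 0 < lam → IsProfile n m β α lam (f lam))
    (hscale : ∀ lam, 0 < lam → ∀ r, 0 ≤ r → f lam r = lam ^ (2 / (1 - m)) * f 1 (lam * r))
    {lam1 lam2 : ℝ} (h1 : 0 < lam1) (h12 : lam1 < lam2) {r : ℝ} (hr : 0 ≤ r) :
    f lam1 r < f lam2 r := by
  obtain ⟨hm1', hD⟩ := lt_one_of_lt_sub_two_div hn hm1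
  have ht : 0 < 1 - m := by linarith
  have h2 : 0 < lam2 := h1.trans h12
  rcases hr.eq_or_lt with rfl | hr
  · rw [(hf lam1 h1).init, (hf lam2 h2).init]
    exact rpow_lt_rpow h1.le h12 (by positivity)
  · have hp := hf 1 one_pos
    have hm := hp.strictMonoOn_scaled hn hm0 hm1 hα hC1 (mul_pos h1 hr : lam1 * r ∈ Ioi 0)
      (mul_pos h2 hr : lam2 * r ∈ Ioi 0) (mul_lt_mul_of_pos_right h12 hr)
    have key : ∀ lam, 0 < lam → (lam * r) ^ 2 * f 1 (lam * r) ^ (1 - m)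
        = r ^ 2 * f lam r ^ (1 - m) := by
      intro lam hl
      have hpos := hp.pos (lam * r) (by positivity)
      rw [hscale lam hl r hr.le, mul_rpow (by positivity) hpos.le, ← rpow_mul hl.le,
        div_mul_cancel₀ _ ht.ne', mul_pow, rpow_two]
      ring
    simp only [key lam1 h1, key lam2 h2] at hm
    have h3 := lt_of_mul_lt_mul_left hm (by positivity)
    exact (rpow_lt_rpow_iff ((hf lam1 h1).pos r hr.le).le ((hf lam2 h2).pos r hr.le).le ht).1 h3

/-- Two ordered profiles have a non-integrable difference with respect to the radial measure. -/
theorem not_integrableOn_profile_sub {k : ℕ} {m β α lam1 lam2 : ℝ} {f g : ℝ → ℝ}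
    (hm0 : 0 < m) (hm1 : m < (((k + 3 : ℕ) : ℝ) - 2) / (k + 3 : ℕ))
    (hα : α = (2 * β + 1) / (1 - m)) (hC1 : CondC1 (k + 3) m β)
    (pf : IsProfile (k + 3) m β α lam1 f) (pg : IsProfile (k + 3) m β α lam2 g)
    (hfg : ∀ r, 0 < r → f r < g r) :
    ¬ IntegrableOn (fun r => r ^ (k + 2) * (g r - f r)) (Ioi 0) := by
  obtain ⟨hm1', hD⟩ := lt_one_of_lt_sub_two_div (Nat.le_add_left 3 k) hm1
  have ht : 0 < 1 - m := by linarith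
  have hcast : ((k + 3 : ℕ) : ℝ) = k + 3 := by push_cast; ring
  have hK : 0 < Cstar (k + 3) m := by rw [Cstar]; positivity
  have hinv : ∀ {x : ℝ}, 0 < x → x ^ (m - 1) * x ^ (1 - m) = 1 := fun hx => by
    rw [← rpow_add hx]; simp
  have hf1 : 0 < f 1 := pf.pos 1 zero_le_one
  refine not_integrableOn_of_flux (β := β) (κ := (k + 3) * β - α) (C := m / f 1 ^ (1 - m))
    (v := fun r => g r ^ m - f r ^ m)
    (v' := fun r => deriv g r * m * g r ^ (m - 1) - deriv f r * m * f r ^ (m - 1))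
    (fun r hr => sub_pos.2 (hfg r hr))
    (fun r hr => ((pg.hasDerivAt hr).sub (pf.hasDerivAt hr)).continuousAt.continuousWithinAt)
    (fun r hr => (pg.hasDerivAt_rpow m hr).sub (pf.hasDerivAt_rpow m hr))
    (fun r hr => sub_pos.2 (rpow_lt_rpow (pf.pos r hr.le).le (hfg r hr) hm0))
    (fun r hr => ?_) ?_ (fun r hr => ?_) (fun hκ r hr => ?_)
  · refine (((pg.hasDerivAt_flux hr).sub (pf.hasDerivAt_flux hr)).congr_deriv
      (by ring)).congr_of_eventuallyEq (Eventually.of_forall fun s => ?_)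
    simp only [Pi.sub_apply]
    ring
  · have h := pg.tendsto_flux_zero.sub pf.tendsto_flux_zero
    rw [sub_zero] at h
    refine h.congr fun s => ?_
    ring
  · have hr0 : 0 < r := one_pos.trans_le hr
    have hfr := pf.pos r hr0.le
    have h1 := rpow_le_rpow_add_mul_sub hm0 hm1'.le hfr (pg.pos r hr0.le)
    have h2 := (pf.strictMonoOn_scaled (Nat.le_add_left 3 k) hm0 hm1 hα hC1).monotoneOn
      (mem_Ioi.2 one_pos) (mem_Ioi.2 hr0) hr
    simp only [one_pow, one_mul] at h2
    have h3 : 0 < f 1 ^ (1 - m) := rpow_pos_of_pos hf1 _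
    have h4 : f r ^ (m - 1) ≤ r ^ 2 / f 1 ^ (1 - m) := by
      rw [le_div_iff₀ h3]
      calc f r ^ (m - 1) * f 1 ^ (1 - m)
          ≤ f r ^ (m - 1) * (r ^ 2 * f r ^ (1 - m)) :=
            mul_le_mul_of_nonneg_left h2 (rpow_nonneg hfr.le _)
        _ = r ^ 2 * (f r ^ (m - 1) * f r ^ (1 - m)) := by ring
        _ = r ^ 2 := by rw [hinv hfr, mul_one]
    have h5 : 0 ≤ m * (g r - f r) := mul_nonneg hm0.le (sub_pos.2 (hfg r hr0)).le
    calc g r ^ m - f r ^ m ≤ m * (g r - f r) * f r ^ (m - 1) := by linarith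
      _ ≤ m * (g r - f r) * (r ^ 2 / f 1 ^ (1 - m)) := mul_le_mul_of_nonneg_left h4 h5
      _ = _ := by ring
  · have hr0 : 0 < r := one_pos.trans_le hr
    have hgr := pg.pos r hr0.le
    have hβD : β * (((k + 3 : ℕ) : ℝ) - 2 - (k + 3 : ℕ) * m) = 1 := by
      rw [hα, sub_eq_zero, eq_div_iff ht.ne'] at hκ
      rw [hcast]
      linarith
    have hβ : 0 < β := by
      by_contra! h
      nlinarith
    have hD2 : 2 * (1 - m) < ((k + 3 : ℕ) : ℝ) - 2 - (k + 3 : ℕ) * m := by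
      rcases hC1.cases hm0 hm1' hD with h | h
      · linarith
      · exact h.1
    have h1 := rpow_le_rpow_add_mul_sub hm0 hm1'.le hgr (pf.pos r hr0.le)
    have h2 := (pg.scaled_lt_and_logSlope_pos (Nat.le_add_left 3 k) hm0 hm1 hα hC1 hr0).1
    rw [div_lt_one hK] at h2
    have hv : 0 < g r ^ m - f r ^ m :=
      sub_pos.2 (rpow_lt_rpow (pf.pos r hr0.le).le (hfg r hr0) hm0)
    have h3 : g r - f r ≤ g r ^ (1 - m) / m * (g r ^ m - f r ^ m) := by
      have h4 : m * g r ^ (m - 1) * (g r - f r) ≤ g r ^ m - f r ^ m := by linarith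
      have h5 := mul_le_mul_of_nonneg_left h4
        (div_nonneg (rpow_nonneg hgr.le (1 - m)) hm0.le)
      calc g r - f r = (g r ^ (m - 1) * g r ^ (1 - m)) * (g r - f r) := by
            rw [hinv hgr, one_mul]
        _ = g r ^ (1 - m) / m * (m * g r ^ (m - 1) * (g r - f r)) := by field_simp
        _ ≤ _ := h5
    have hβK : β * (Cstar (k + 3) m / m) = 2 / (1 - m) := by
      rw [Cstar]
      field_simp
      linarith
    have hk : 2 / (1 - m) ≤ (k : ℝ) + 1 := by
      rw [div_le_iff₀ ht]
      rw [hcast] at hD2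
      linarith
    calc β * (r ^ 2 * (g r - f r))
        ≤ β * (r ^ 2 * (g r ^ (1 - m) / m * (g r ^ m - f r ^ m))) := by gcongr
      _ = β * (r ^ 2 * g r ^ (1 - m) / m) * (g r ^ m - f r ^ m) := by ring
      _ ≤ β * (Cstar (k + 3) m / m) * (g r ^ m - f r ^ m) := by gcongr
      _ ≤ (k + 1) * (g r ^ m - f r ^ m) := by rw [hβK]; gcongr

/-- Case (C1): `n − 2/(1−m) − γ₁ > 0`, the profiles are monotone increasing in `λ`, and the
difference of two distinct profiles is not integrable on `ℝ^n`. -/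
theorem profiles_monotone_nonintegrable_C1 (n : ℕ) (m β α : ℝ) (hn : 3 ≤ n) (hm0 : 0 < m)
    (hm1 : m < ((n : ℝ) - 2) / n) (hα : α = (2 * β + 1) / (1 - m)) (hC1 : CondC1 n m β)
    (f : ℝ → ℝ → ℝ) (hf : ∀ lam, 0 < lam → IsProfile n m β α lam (f lam))
    (hscale : ∀ lam, 0 < lam → ∀ r, 0 ≤ r → f lam r = lam ^ (2 / (1 - m)) * f 1 (lam * r)) :
    0 < (n : ℝ) - 2 / (1 - m) - gamma1 n m β ∧
    ∀ lam1 lam2 : ℝ, 0 < lam1 → lam1 < lam2 →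
      (∀ r, 0 ≤ r → f lam1 r < f lam2 r) ∧
      ¬ Integrable (fun x : EuclideanSpace ℝ (Fin n) => f lam1 ‖x‖ - f lam2 ‖x‖) := by
  obtain ⟨hm1', hD⟩ := lt_one_of_lt_sub_two_div hn hm1
  refine ⟨hC1.gamma1_lt hm0 hm1' hD, fun lam1 lam2 h1 h12 => ?_⟩
  have hlt : ∀ r, 0 ≤ r → f lam1 r < f lam2 r := fun r hr =>
    profile_lt_of_lt hn hm0 hm1 hα hC1 hf hscale h1 h12 hr
  refine ⟨hlt, fun h_int => ?_⟩
  obtain ⟨k, rfl⟩ : ∃ k, n = k + 3 := ⟨n - 3, by omega⟩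
  rw [integrable_fun_norm_addHaar volume (f := fun r => f lam1 r - f lam2 r)] at h_int
  simp only [finrank_euclideanSpace_fin, Nat.add_succ_sub_one, smul_eq_mul] at h_int
  refine not_integrableOn_profile_sub hm0 hm1 hα hC1 (hf lam1 h1) (hf lam2 (h1.trans h12))
    (fun r hr => hlt r hr.le) (h_int.neg.congr_fun (fun r _ => ?_) measurableSet_Ioi)
  simp only [Pi.neg_apply]
  ring
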